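/- For every j ∈ {1, 2, …, n}, the j-th largest eigenvalue satisfies μ_j(A_α) ≥ 2αm/n − √( ((j−1)/(n−j+1)) · [ nα² Σ_{i=1}^n d_i² + 2mn(1−α)² − 4α²m² ] / n² ). -/

import Mathlib

open Finset

/-- The squares of the eigenvalues of a Hermitian matrix sum to its squared Frobenius norm. -/
lemma Matrix.IsHermitian.sum_eigenvalues_sq {ι : Type*} [Fintype ι] [DecidableEq ι]
    {A : Matrix ι ι ℂ} (hA : A.IsHermitian) :
    ∑ i, hA.eigenvalues i ^ 2 = ∑ i, ∑ j, Complex.normSq (A i j) := by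
  have htrace : (A * A).trace = ∑ i, ((hA.eigenvalues i : ℂ)) ^ 2 := by
    conv_lhs => rw [hA.spectral_theorem, ← map_mul, Unitary.conjStarAlgAut_apply,
      Matrix.trace_mul_cycle, Unitary.coe_star_mul_self, one_mul, Matrix.diagonal_mul_diagonal,
      Matrix.trace_diagonal]
    simp [sq]
  have hentries : (A * A).trace = ∑ i, ∑ j, (Complex.normSq (A i j) : ℂ) := by
    simp only [Matrix.trace, Matrix.diag_apply, Matrix.mul_apply]
    refine sum_congr rfl fun i _ => sum_congr rfl fun j _ => ?_
    rw [← hA.apply j i, Complex.star_def, Complex.mul_conj]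
  exact_mod_cast htrace.symm.trans hentries

/-- A lower bound for the entries of a decreasing sequence with zero sum
in terms of its sum of squares. -/
lemma Antitone.neg_sqrt_le_of_sum_eq_zero {n : ℕ} {x : Fin n → ℝ} (hx : Antitone x)
    (hsum : ∑ i, x i = 0) (k : Fin n) :
    -√((k : ℝ) / (n - k) * ((∑ i, x i ^ 2) / n)) ≤ x k := by
  rcases le_or_gt 0 (x k) with hk | hk
  · exact (neg_nonpos.2 (Real.sqrt_nonneg _)).trans hk
  have hkn : (k : ℝ) < n := by exact_mod_cast k.isLt
  have hk0 : (0 : ℝ) ≤ k := Nat.cast_nonneg _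
  have hsplit := sum_add_sum_compl (Iio k) x
  have hsplit_sq := sum_add_sum_compl (Iio k) fun i => x i ^ 2
  have hcard : (#(Iio k)ᶜ : ℝ) = n - k := by
    rw [card_compl, Fin.card_Iio, Fintype.card_fin, Nat.cast_sub k.isLt.le]
  have hcs := sq_sum_le_card_mul_sum_sq (s := Iio k) (f := x)
  have hcs_compl := sq_sum_le_card_mul_sum_sq (s := (Iio k)ᶜ) (f := x)
  rw [Fin.card_Iio] at hcs
  rw [hcard] at hcs_compl
  have hupper : ∑ i ∈ (Iio k)ᶜ, x i ≤ (n - k) * x k := by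
    rw [← hcard, ← nsmul_eq_mul]
    exact sum_le_card_nsmul _ _ _ fun i hi => hx (by simpa using hi)
  rw [hsum] at hsplit
  rw [eq_neg_of_add_eq_zero_left hsplit] at hcs
  rw [← hsplit_sq]
  set Q := ∑ i ∈ (Iio k)ᶜ, x i
  set S := ∑ i ∈ Iio k, x i ^ 2
  set T := ∑ i ∈ (Iio k)ᶜ, x i ^ 2
  have hd : (0 : ℝ) < n - k := sub_pos.2 hkn
  have hn : (0 : ℝ) < n := hk0.trans_lt hkn
  have hQ : ((n - k) * x k) ^ 2 ≤ Q ^ 2 :=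
    sq_le_sq.2 (abs_le_abs_of_nonpos (mul_nonpos_of_nonneg_of_nonpos hd.le hk.le) hupper)
  have hmain : (n - k) * (n * (n - k) * x k ^ 2) ≤ (n - k) * (k * (S + T)) := by
    nlinarith [mul_le_mul_of_nonneg_left hcs hd.le, mul_le_mul_of_nonneg_left hcs_compl hk0,
      mul_le_mul_of_nonneg_left hQ hn.le]
  have hmain := le_of_mul_le_mul_left hmain hd
  refine neg_le.1 (Real.le_sqrt_of_sq_le ?_)
  rw [div_mul_div_comm, le_div_iff₀ (mul_pos hd hn)]
  linarith

/-- The entries of an antitone sequence are at least its mean minus a multiple of its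
standard deviation. -/
lemma Antitone.mean_sub_sqrt_le {n : ℕ} {μ : Fin n → ℝ} (hμ : Antitone μ) (k : Fin n) :
    (∑ i, μ i) / n -
      √((k : ℝ) / (n - k) * ((n * (∑ i, μ i ^ 2) - (∑ i, μ i) ^ 2) / n ^ 2)) ≤ μ k := by
  have hn : (n : ℝ) ≠ 0 := Nat.cast_ne_zero.2 (Fin.pos k).ne'
  set c := (∑ i, μ i) / n with hc
  have hsum : ∑ i, μ i = n * c := by rw [hc]; field_simp
  have hbound := Antitone.neg_sqrt_le_of_sum_eq_zero (x := fun i => μ i - c)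
    (fun i j hij => sub_le_sub_right (hμ hij) c) (by simp [sum_sub_distrib, hsum]) k
  have hsq : (∑ i, (μ i - c) ^ 2) / n = (n * (∑ i, μ i ^ 2) - (∑ i, μ i) ^ 2) / n ^ 2 := by
    have : ∑ i, (μ i - c) ^ 2 = ∑ i, μ i ^ 2 - n * c ^ 2 := by
      simp only [sub_sq, sum_add_distrib, sum_sub_distrib, ← sum_mul, ← mul_sum, hsum, sum_const,
        card_univ, Fintype.card_fin, nsmul_eq_mul]
      ring
    rw [this, hsum]
    field_simp
  rw [hsq] at hbound
  linarith

lemma Complex.normSq_one_add_sqrt_three_mul_I_div_two :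
    Complex.normSq ((1 + Real.sqrt 3 * Complex.I) / 2 : ℂ) = 1 := by
  have h : Complex.normSq (1 + Real.sqrt 3 * Complex.I) = 4 := by
    have := Complex.normSq_add_mul_I 1 (√3)
    rw [Real.sq_sqrt (by norm_num)] at this
    norm_num at this ⊢
    exact this
  rw [Complex.normSq_div, h, Complex.normSq_ofNat]
  norm_num

theorem stmt_13
    (n m : ℕ) (hn : 0 < n)
    (G : SimpleGraph (Fin n)) [DecidableRel G.Adj]
    (hm : G.edgeFinset.card = m)
    (H : Matrix (Fin n) (Fin n) ℂ) (hHherm : H.IsHermitian)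
    (hHdiag : ∀ v, H v v = 0)
    (hHzero : ∀ v u, v ≠ u → ¬ G.Adj v u → H v u = 0)
    (hHedge : ∀ v u, G.Adj v u →
      H v u = 1 ∨ H v u = ((1 + Real.sqrt 3 * Complex.I) / 2 : ℂ) ∨ H v u = (starRingEnd ℂ) ((1 + Real.sqrt 3 * Complex.I) / 2 : ℂ))
    (α : ℝ) (hα : α ∈ Set.Icc (0 : ℝ) 1)
    (A : Matrix (Fin n) (Fin n) ℂ)
    (hA : A = (α : ℂ) • Matrix.diagonal (fun i => (G.degree i : ℂ)) + ((1 - α : ℝ) : ℂ) • H)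
    (hAherm : A.IsHermitian)
    (μ : Fin n → ℝ) (hmono : Antitone μ)
    (hperm : ∃ e : Equiv.Perm (Fin n), μ = hAherm.eigenvalues ∘ e)
    (j : ℕ) (hj1 : 1 ≤ j) (hjn : j ≤ n) :
    μ ⟨j - 1, by omega⟩ ≥ 2 * α * m / n -
      Real.sqrt (((j : ℝ) - 1) / ((n : ℝ) - j + 1) * (((n : ℝ) * α ^ 2 * (∑ i, (G.degree i : ℝ) ^ 2) + 2 * (m : ℝ) * n * (1 - α) ^ 2 - 4 * α ^ 2 * (m : ℝ) ^ 2) / (n : ℝ) ^ 2)) := by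
  obtain ⟨e, he⟩ := hperm
  have hdeg : ∑ i, (G.degree i : ℝ) = 2 * m := by
    exact_mod_cast hm ▸ G.sum_degrees_eq_twice_card_edges
  have htrace : ∑ i, μ i = 2 * α * m := by
    have h := hAherm.trace_eq_sum_eigenvalues
    have hA' : A.trace = ((α * ∑ i, (G.degree i : ℝ) : ℝ) : ℂ) := by
      simp [hA, Matrix.trace, hHdiag, mul_sum]
    rw [hA'] at h
    have h : α * ∑ i, (G.degree i : ℝ) = ∑ i, hAherm.eigenvalues i := by
      refine Complex.ofReal_injective (h.trans ?_)
      rw [Complex.ofReal_sum]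
      rfl
    rw [he, Function.comp_def, Equiv.sum_comp e hAherm.eigenvalues, ← h, hdeg]
    ring
  have hentry : ∀ i u, Complex.normSq (A i u) =
      (if i = u then α ^ 2 * (G.degree i : ℝ) ^ 2 else 0) +
        (if G.Adj i u then (1 - α) ^ 2 else 0) := by
    intro i u
    rcases eq_or_ne i u with rfl | hne
    · simp [hA, hHdiag, Complex.normSq_natCast]
      ring
    · have hAiu : A i u = ((1 - α : ℝ) : ℂ) * H i u := by
        simp [hA, Matrix.diagonal_apply_ne _ hne]
      rw [hAiu, Complex.normSq_mul, Complex.normSq_ofReal, if_neg hne, zero_add, ← sq]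
      split_ifs with hadj
      · rcases hHedge i u hadj with h | h | h <;>
          simp only [h, Complex.normSq_conj, Complex.normSq_one_add_sqrt_three_mul_I_div_two,
            map_one, mul_one]
      · simp [hHzero i u hne hadj]
  have hsq : ∑ i, μ i ^ 2 =
      α ^ 2 * ∑ i, (G.degree i : ℝ) ^ 2 + 2 * m * (1 - α) ^ 2 := by
    rw [he]
    simp only [Function.comp_apply]
    rw [Equiv.sum_comp e fun i => hAherm.eigenvalues i ^ 2, hAherm.sum_eigenvalues_sq]
    simp only [hentry, sum_add_distrib, sum_ite_eq, mem_univ, if_true, ← mul_sum]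
    congr 1
    simp only [← sum_filter, sum_const, ← G.neighborFinset_eq_filter,
      G.card_neighborFinset_eq_degree, nsmul_eq_mul, ← sum_mul, hdeg]
  have hbound := hmono.mean_sub_sqrt_le ⟨j - 1, by omega⟩
  rw [htrace, hsq] at hbound
  simp only [Nat.cast_sub hj1, Nat.cast_one] at hbound
  refine ge_iff_le.2 (le_of_eq_of_le ?_ hbound)
  congr 3
  · congr 1
    ring
  · congr 1
    ring
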